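/- Let J : ℚ_p^n → [0,∞) satisfy Hypothesis A and set f(ξ) = 1 − (FJ)(ξ). Then f is negative definite: for every m ∈ ℕ, all x_1, …, x_m ∈ ℚ_p^n and all λ_1, …, λ_m ∈ ℂ, the sum Σ_{i,j=1}^m ( f(x_i) + \overline{f(x_j)} − f(x_i − x_j) ) λ_i \overline{λ_j} is a nonnegative real number. -/

import Mathlib

open MeasureTheory Filter

noncomputable section

namespace PadicPaper

attribute [local instance] Classical.propDecidable

variable (p : ℕ) [Fact p.Prime]

instance : MeasurableSpace ℚ_[p] := borel _
instance : BorelSpace ℚ_[p] := ⟨rfl⟩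

variable (n : ℕ)

/-- `ℚ_p^n` with the sup norm `‖x‖ = max |x i|_p`. -/
abbrev V := Fin n → ℚ_[p]

/-- The `p`-adic fractional part of `y`: the unique rational `r ∈ [0,1)` whose denominator is a
power of `p` such that `y - r ∈ ℤ_p`. -/
def frac (y : ℚ_[p]) : ℚ :=
  if h : ∃ r : ℚ, 0 ≤ r ∧ r < 1 ∧ (∃ m : ℕ, (r * (p : ℚ) ^ m).den = 1) ∧ ‖y - (r : ℚ_[p])‖ ≤ 1
  then h.choose else 0

/-- The standard additive character `χ_p(y) = exp(2 π i {y}_p)` of `ℚ_p`. -/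
def stdChar (y : ℚ_[p]) : ℂ := Complex.exp (2 * Real.pi * Complex.I * (frac p y : ℂ))

/-- `ξ·x = Σ ξ_i x_i`. -/
def dotP (ξ x : V p n) : ℚ_[p] := ∑ i, ξ i * x i

/-- Fourier transform with respect to the (normalized Haar) measure `μ`:
`(Ff)(ξ) = ∫ χ_p(ξ·x) f(x) dμ(x)`. -/
def FT (μ : Measure (V p n)) (f : V p n → ℂ) (ξ : V p n) : ℂ :=
  ∫ x, stdChar p (dotP p n ξ x) * f x ∂μ

/-- `ℤ_p^n` as a subset of `ℚ_p^n`. -/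
def Zpn : Set (V p n) := {x | ‖x‖ ≤ 1}

/-- Hypothesis A: `J` is a nonnegative radial a.e.-continuous function with total integral 1. -/
structure HypA (μ : Measure (V p n)) (J : V p n → ℝ) : Prop where
  nonneg : ∀ x, 0 ≤ J x
  radial : ∀ x y : V p n, ‖x‖ = ‖y‖ → J x = J y
  aecont : ∀ᵐ x ∂μ, ContinuousAt J x
  integrable : Integrable J μ
  int_one : ∫ x, J x ∂μ = 1

/-- The Fourier transform of (the complexification of) `J`. -/
def FJ (μ : Measure (V p n)) (J : V p n → ℝ) (ξ : V p n) : ℂ :=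
  FT p n μ (fun x => (J x : ℂ)) ξ

/-- A representative point of `ℚ_p^n` of norm `r` (junk value `0` if no such point exists);
used to evaluate radial functions at a given radius. -/
def repVec (r : ℝ) : V p n :=
  if h : ∃ v : V p n, ‖v‖ = r then h.choose else 0

/-- The heat kernel
`Z_t(x) = ‖x‖^{-n} (1-p^{-n}) Σ_{j≥0} p^{-nj} (e^{-t(1-(FJ)(p^{-j}‖x‖⁻¹))} - e^{-t(1-(FJ)(p‖x‖⁻¹))})`. -/
def heatZ (μ : Measure (V p n)) (J : V p n → ℝ) (t : ℝ) (x : V p n) : ℝ :=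
  ‖x‖ ^ (-(n : ℤ)) * (1 - (p : ℝ) ^ (-(n : ℤ))) * ∑' j : ℕ,
    (p : ℝ) ^ (-((n * j : ℕ) : ℤ)) *
      (Real.exp (-(t * (1 - (FJ p n μ J (repVec p n ((p : ℝ) ^ (-(j : ℤ)) * ‖x‖⁻¹))).re))) -
       Real.exp (-(t * (1 - (FJ p n μ J (repVec p n ((p : ℝ) * ‖x‖⁻¹))).re))))

/-- `J` is of linear type: Hypothesis A together with `B‖x‖^{-(α+1)} ≤ J(x) ≤ C‖x‖^{-(α+1)}`. -/
structure LinearType (μ : Measure (V p n)) (J : V p n → ℝ) (B C α : ℝ) : Prop where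
  hypA : HypA p n μ J
  hB : 0 < B
  hBC : B ≤ C
  hα : 0 < α
  lower : ∀ x : V p n, x ≠ 0 → B / ‖x‖ ^ (α + 1) ≤ J x
  upper : ∀ x : V p n, x ≠ 0 → J x ≤ C / ‖x‖ ^ (α + 1)

/-- `J` is of logarithmic type: Hypothesis A together with
`D ln^α(1+‖x‖)‖x‖^{-β} ≤ J(x) ≤ E ln^α(1+‖x‖)‖x‖^{-β}`. -/
structure LogType (μ : Measure (V p n)) (J : V p n → ℝ) (D E α β : ℝ) : Prop where
  hypA : HypA p n μ J
  hD : 0 < D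
  hDE : D ≤ E
  hα : 0 < α
  hβ : 0 < β
  lower : ∀ x : V p n, x ≠ 0 → D * Real.log (1 + ‖x‖) ^ α / ‖x‖ ^ β ≤ J x
  upper : ∀ x : V p n, x ≠ 0 → J x ≤ E * Real.log (1 + ‖x‖) ^ α / ‖x‖ ^ β

/-- The lower incomplete gamma function `γ(s,x) = ∫_0^x z^{s-1} e^{-z} dz`. -/
def lgamma (s x : ℝ) : ℝ := ∫ z in (0:ℝ)..x, z ^ (s - 1) * Real.exp (-z)


/-- A rational in `ℤ[1/p]` with `p`-adic norm at most one is an integer. -/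
theorem int_of_norm_le (d : ℚ) (m : ℕ) (k : ℤ) (h : d * (p : ℚ) ^ m = k)
    (hd : ‖(d : ℚ_[p])‖ ≤ 1) : ∃ c : ℤ, d = c := by
  have hp : (p : ℚ) ≠ 0 := by exact_mod_cast (Fact.out : p.Prime).ne_zero
  have h2 : (d : ℚ_[p]) * (p : ℚ_[p]) ^ m = (k : ℚ_[p]) := by exact_mod_cast congrArg (Rat.cast : ℚ → ℚ_[p]) h
  have h3 : ‖(k : ℚ_[p])‖ ≤ (p : ℝ) ^ (-m : ℤ) := by
    rw [← h2, norm_mul, Padic.norm_p_pow]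
    exact mul_le_of_le_one_left (by positivity) hd
  obtain ⟨c, hc⟩ := (Padic.norm_int_le_pow_iff_dvd k m).1 h3
  refine ⟨c, ?_⟩
  have hpm : (p : ℚ) ^ m ≠ 0 := pow_ne_zero _ hp
  apply mul_right_cancel₀ hpm
  rw [h, hc]; push_cast; ring

theorem frac_exists (y : ℚ_[p]) :
    ∃ r : ℚ, 0 ≤ r ∧ r < 1 ∧ (∃ m : ℕ, (r * (p : ℚ) ^ m).den = 1) ∧
      ‖y - (r : ℚ_[p])‖ ≤ 1 := by
  have hp1 : (1 : ℝ) < p := by exact_mod_cast (Fact.out : p.Prime).one_lt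
  have hp : (0 : ℚ) < p := by exact_mod_cast (Fact.out : p.Prime).pos
  have hpp : (p : ℚ_[p]) ≠ 0 := by exact_mod_cast (Fact.out : p.Prime).ne_zero
  obtain ⟨m, hm⟩ := pow_unbounded_of_one_lt ‖y‖ hp1
  have hz : ‖y * (p : ℚ_[p]) ^ m‖ ≤ 1 := by
    rw [norm_mul, Padic.norm_p_pow, zpow_neg, zpow_natCast, ← div_eq_mul_inv]
    exact div_le_one_of_le₀ hm.le (by positivity)
  let z : ℤ_[p] := ⟨y * (p : ℚ_[p]) ^ m, hz⟩
  have hs := (PadicInt.norm_le_pow_iff_mem_span_pow _ m).2 (PadicInt.appr_spec m z)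
  have hpm : (0 : ℚ) < (p : ℚ) ^ m := pow_pos hp m
  refine ⟨(z.appr m : ℚ) / (p : ℚ) ^ m, by positivity, ?_, ⟨m, ?_⟩, ?_⟩
  · rw [div_lt_one hpm]
    exact_mod_cast PadicInt.appr_lt z m
  · rw [div_mul_cancel₀ _ hpm.ne']
    exact Rat.den_natCast _
  · have e : ‖y * (p : ℚ_[p]) ^ m - (z.appr m : ℚ_[p])‖ ≤ (p : ℝ) ^ (-m : ℤ) := by
      rw [PadicInt.norm_def, PadicInt.coe_sub, PadicInt.coe_natCast] at hs
      exact hs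
    have e2 : y - (((z.appr m : ℚ) / (p : ℚ) ^ m : ℚ) : ℚ_[p])
        = (y * (p : ℚ_[p]) ^ m - (z.appr m : ℚ_[p])) / (p : ℚ_[p]) ^ m := by
      push_cast
      field_simp
    rw [e2, norm_div, Padic.norm_p_pow]
    exact div_le_one_of_le₀ e (by positivity)

theorem frac_spec (y : ℚ_[p]) :
    (∃ m : ℕ, ∃ k : ℤ, frac p y * (p : ℚ) ^ m = k) ∧ ‖y - (frac p y : ℚ_[p])‖ ≤ 1 := by
  have h := frac_exists p y
  have e : frac p y = h.choose := by unfold frac; rw [dif_pos h]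
  rw [e]
  obtain ⟨_, _, ⟨m, hm⟩, h4⟩ := h.choose_spec
  exact ⟨⟨m, _, (Rat.den_eq_one_iff _).1 hm |>.symm⟩, h4⟩

theorem stdChar_eq (y : ℚ_[p]) (r : ℚ) (hr : ∃ m : ℕ, ∃ k : ℤ, r * (p : ℚ) ^ m = k)
    (h : ‖y - (r : ℚ_[p])‖ ≤ 1) :
    stdChar p y = Complex.exp (2 * Real.pi * Complex.I * (r : ℂ)) := by
  obtain ⟨⟨m, k, hk⟩, h1⟩ := frac_spec p y
  obtain ⟨m', k', hk'⟩ := hr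
  obtain ⟨c, hc⟩ : ∃ c : ℤ, frac p y - r = c := by
    apply int_of_norm_le p _ (m + m') (k * p ^ m' - k' * p ^ m)
    · push_cast
      rw [← hk, ← hk']; ring
    · have : (((frac p y - r : ℚ)) : ℚ_[p]) = (y - (r : ℚ_[p])) - (y - (frac p y : ℚ_[p])) := by
        push_cast; ring
      rw [this]
      have := Padic.nonarchimedean (y - (r : ℚ_[p])) (-(y - (frac p y : ℚ_[p])))
      rw [← sub_eq_add_neg, norm_neg] at this
      exact this.trans (max_le h h1)
  unfold stdChar
  rw [Complex.exp_eq_exp_iff_exists_int]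
  refine ⟨c, ?_⟩
  have : (frac p y : ℂ) = r + c := by
    have : frac p y = r + c := by linarith
    rw [this]; push_cast; ring
  rw [this]; ring

theorem stdChar_sub (a b : ℚ_[p]) :
    stdChar p (a - b) = stdChar p a * (starRingEnd ℂ) (stdChar p b) := by
  obtain ⟨⟨m, k, hk⟩, h1⟩ := frac_spec p a
  obtain ⟨⟨m', k', hk'⟩, h2⟩ := frac_spec p b
  rw [stdChar_eq p (a - b) (frac p a - frac p b)]
  · unfold stdChar
    rw [← Complex.exp_conj, ← Complex.exp_add]
    congr 1
    simp only [map_mul, Complex.conj_I, Complex.conj_ofReal, map_ofNat, map_ratCast]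
    push_cast; ring
  · refine ⟨m + m', k * p ^ m' - k' * p ^ m, ?_⟩
    push_cast
    rw [← hk, ← hk']; ring
  · have : a - b - ((frac p a - frac p b : ℚ) : ℚ_[p])
        = (a - (frac p a : ℚ_[p])) + (-(b - (frac p b : ℚ_[p]))) := by push_cast; ring
    rw [this]
    refine (Padic.nonarchimedean _ _).trans ?_
    rw [norm_neg]
    exact max_le h1 h2

theorem stdChar_continuous : Continuous (stdChar p) := by
  apply IsLocallyConstant.continuous
  rw [IsLocallyConstant.iff_eventually_eq]
  intro b
  filter_upwards [Metric.ball_mem_nhds b one_pos] with a ha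
  obtain ⟨h0, h2⟩ := frac_spec p b
  rw [stdChar_eq p a (frac p b) h0]
  · rfl
  · have : a - (frac p b : ℚ_[p]) = (a - b) + (b - (frac p b : ℚ_[p])) := by ring
    rw [this]
    refine (Padic.nonarchimedean _ _).trans (max_le ?_ h2)
    rw [Metric.mem_ball, dist_eq_norm] at ha
    exact ha.le

theorem norm_stdChar (y : ℚ_[p]) : ‖stdChar p y‖ = 1 := by
  unfold stdChar
  have : (2 * Real.pi * Complex.I * (frac p y : ℂ))
    = ((2 * Real.pi * (frac p y : ℝ) : ℝ) : ℂ) * Complex.I := by push_cast; ring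
  rw [this, Complex.norm_exp_ofReal_mul_I]

theorem char_continuous (ξ : V p n) : Continuous fun x : V p n => stdChar p (dotP p n ξ x) := by
  apply (stdChar_continuous p).comp
  unfold dotP
  fun_prop

theorem char_integrable (μ : Measure (V p n)) (J : V p n → ℝ) (hJ : Integrable J μ) (ξ : V p n) :
    Integrable (fun x => stdChar p (dotP p n ξ x) * (J x : ℂ)) μ := by
  apply hJ.ofReal.bdd_mul (c := 1) (char_continuous p n ξ).aestronglyMeasurable
  exact Eventually.of_forall fun x => (norm_stdChar p _).le

theorem term_eq (μ : Measure (V p n)) (J : V p n → ℝ) (hJ : HypA p n μ J) (a b : V p n) :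
    Integrable (fun x => (1 - stdChar p (dotP p n a x)) *
      (starRingEnd ℂ) (1 - stdChar p (dotP p n b x)) * (J x : ℂ)) μ ∧
    (1 - FJ p n μ J a) + (starRingEnd ℂ) (1 - FJ p n μ J b) - (1 - FJ p n μ J (a - b)) =
      ∫ x, (1 - stdChar p (dotP p n a x)) *
        (starRingEnd ℂ) (1 - stdChar p (dotP p n b x)) * (J x : ℂ) ∂μ := by
  have i0 : Integrable (fun x => (J x : ℂ)) μ := hJ.integrable.ofReal
  have ia := char_integrable p n μ J hJ.integrable a
  have ib := char_integrable p n μ J hJ.integrable b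
  have iab := char_integrable p n μ J hJ.integrable (a - b)
  have ib' : Integrable (fun x => (starRingEnd ℂ) (stdChar p (dotP p n b x) * (J x : ℂ))) μ :=
    (LinearIsometryEquiv.integrable_comp_iff (Complex.conjLIE)).2 ib
  have e : (fun x => (1 - stdChar p (dotP p n a x)) *
      (starRingEnd ℂ) (1 - stdChar p (dotP p n b x)) * (J x : ℂ)) =
      fun x => (J x : ℂ) - stdChar p (dotP p n a x) * (J x : ℂ)
        - (starRingEnd ℂ) (stdChar p (dotP p n b x) * (J x : ℂ))
        + stdChar p (dotP p n (a - b) x) * (J x : ℂ) := by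
    funext x
    have : dotP p n (a - b) x = dotP p n a x - dotP p n b x := by
      simp [dotP, sub_mul, Finset.sum_sub_distrib]
    rw [this, stdChar_sub]
    simp only [map_sub, map_one, map_mul, Complex.conj_ofReal]
    ring
  have one : ∫ x, (J x : ℂ) ∂μ = 1 := by
    rw [integral_complex_ofReal, hJ.int_one]; simp
  rw [e]
  have i1 : Integrable (fun x => (J x : ℂ) - stdChar p (dotP p n a x) * (J x : ℂ)) μ := i0.sub ia
  have i2 : Integrable (fun x => (J x : ℂ) - stdChar p (dotP p n a x) * (J x : ℂ)
        - (starRingEnd ℂ) (stdChar p (dotP p n b x) * (J x : ℂ))) μ := i1.sub ib'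
  refine ⟨i2.add iab, ?_⟩
  rw [integral_add i2 iab, integral_sub i1 ib', integral_sub i0 ia,
    one, integral_conj]
  simp only [FJ, FT, map_sub, map_one]
  ring

/-- If `J` satisfies Hypothesis A then `f(ξ) = 1 - (FJ)(ξ)` is negative definite:
each sum `Σ_{i,j} (f(x_i) + conj (f(x_j)) - f(x_i - x_j)) λ_i conj (λ_j)` is a nonnegative
real number. -/
theorem statement2 (hn : 0 < n) (μ : Measure (V p n)) [μ.IsAddHaarMeasure]
    (hμ : μ (Zpn p n) = 1) (J : V p n → ℝ) (hJ : HypA p n μ J) :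
    ∀ (m : ℕ) (x : Fin m → V p n) (lam : Fin m → ℂ),
      ∃ r : ℝ, 0 ≤ r ∧
        (∑ i : Fin m, ∑ j : Fin m,
          ((1 - FJ p n μ J (x i)) + (starRingEnd ℂ) (1 - FJ p n μ J (x j)) -
            (1 - FJ p n μ J (x i - x j))) * lam i * (starRingEnd ℂ) (lam j)) = (r : ℂ) := by
  intro m x lam
  refine ⟨∫ y, Complex.normSq (∑ i, lam i * (1 - stdChar p (dotP p n (x i) y))) * J y ∂μ,
    integral_nonneg fun y => mul_nonneg (Complex.normSq_nonneg _) (hJ.nonneg y), ?_⟩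
  have hI : ∀ i j, Integrable (fun y => (1 - stdChar p (dotP p n (x i) y)) *
      (starRingEnd ℂ) (1 - stdChar p (dotP p n (x j) y)) * (J y : ℂ) *
        (lam i * (starRingEnd ℂ) (lam j))) μ := fun i j =>
    (term_eq p n μ J hJ (x i) (x j)).1.mul_const _
  rw [← integral_complex_ofReal]
  calc _ = ∑ i, ∑ j, ∫ y, (1 - stdChar p (dotP p n (x i) y)) *
      (starRingEnd ℂ) (1 - stdChar p (dotP p n (x j) y)) * (J y : ℂ) *
        (lam i * (starRingEnd ℂ) (lam j)) ∂μ := by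
        refine Finset.sum_congr rfl fun i _ => Finset.sum_congr rfl fun j _ => ?_
        rw [(term_eq p n μ J hJ (x i) (x j)).2, integral_mul_const, mul_assoc]
    _ = ∫ y, ∑ i, ∑ j, (1 - stdChar p (dotP p n (x i) y)) *
      (starRingEnd ℂ) (1 - stdChar p (dotP p n (x j) y)) * (J y : ℂ) *
        (lam i * (starRingEnd ℂ) (lam j)) ∂μ := by
        rw [integral_finsetSum _ fun i _ => integrable_finsetSum _ fun j _ => hI i j]
        refine Finset.sum_congr rfl fun i _ => ?_
        rw [integral_finsetSum _ fun j _ => hI i j]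
    _ = _ := by
        congr 1
        funext y
        rw [Complex.ofReal_mul, ← Complex.mul_conj, map_sum, Finset.sum_mul_sum, Finset.sum_mul]
        refine Finset.sum_congr rfl fun i _ => ?_
        rw [Finset.sum_mul]
        refine Finset.sum_congr rfl fun j _ => ?_
        rw [map_mul]
        ring

end PadicPaper
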